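/- Every graph of treewidth k with n vertices admits a tree-decomposition of width at most 3k+2 whose underlying tree is binary and has depth at most 2⌈log_{5/4}(2n)⌉. -/

import Mathlib

open scoped Classical

/-! ### Arithmetic formulas -/

inductive Formula (K : Type) (ν : Type) where
  | const : K → Formula K ν
  | var : ν → Formula K ν
  | add : Formula K ν → Formula K ν → Formula K ν
  | mul : Formula K ν → Formula K ν → Formula K ν

namespace Formula
variable {K ν : Type}

/-- Number of gates of a formula. -/
def size : Formula K ν → ℕ
  | const _ => 1
  | var _ => 1
  | add f g => f.size + g.size + 1
  | mul f g => f.size + g.size + 1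

/-- Depth of a formula: longest path from an input to the output. -/
def depth : Formula K ν → ℕ
  | const _ => 0
  | var _ => 0
  | add f g => max f.depth g.depth + 1
  | mul f g => max f.depth g.depth + 1

def eval [CommRing K] (x : ν → K) : Formula K ν → K
  | const c => c
  | var v => x v
  | add f g => f.eval x + g.eval x
  | mul f g => f.eval x * g.eval x

/-- The polynomial computed by a formula. -/
noncomputable def toPoly [CommRing K] : Formula K ν → MvPolynomial ν K
  | const c => MvPolynomial.C c
  | var v => MvPolynomial.X v
  | add f g => f.toPoly + g.toPoly
  | mul f g => f.toPoly * g.toPoly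

/-- The set of variables appearing in a formula. -/
def varSet : Formula K ν → Set ν
  | const _ => ∅
  | var v => {v}
  | add f g => f.varSet ∪ g.varSet
  | mul f g => f.varSet ∪ g.varSet

/-- All constants of the formula are 0 or 1. -/
def ZeroOneConsts [Zero K] [One K] : Formula K ν → Prop
  | const c => c = 0 ∨ c = 1
  | var _ => True
  | add f g => f.ZeroOneConsts ∧ g.ZeroOneConsts
  | mul f g => f.ZeroOneConsts ∧ g.ZeroOneConsts

end Formula

/-! ### Arithmetic circuits -/

inductive CGate (K ν : Type) (n : ℕ) where
  | const : K → CGate K ν n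
  | var : ν → CGate K ν n
  | add : Fin n → Fin n → CGate K ν n
  | mul : Fin n → Fin n → CGate K ν n

def CGate.IsInput {K ν : Type} {n : ℕ} : CGate K ν n → Prop
  | .const _ => True
  | .var _ => True
  | _ => False

/-- An arithmetic circuit: an acyclic digraph of gates, the last gate being the output. -/
structure Circuit (K ν : Type) where
  size : ℕ
  pos : 0 < size
  gate : Fin size → CGate K ν size
  wf : ∀ i a b, (gate i = .add a b ∨ gate i = .mul a b) → a < i ∧ b < i

namespace Circuit
variable {K ν : Type}

def output (c : Circuit K ν) : Fin c.size := ⟨c.size - 1, Nat.sub_lt c.pos Nat.one_pos⟩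

def evalGate {R : Type} [CommRing R] (c : Circuit K ν) (cst : K → R) (x : ν → R) :
    Fin c.size → R := fun i =>
  match h : c.gate i with
  | .const a => cst a
  | .var v => x v
  | .add a b =>
      have hlt := c.wf i a b (Or.inl h)
      c.evalGate cst x a + c.evalGate cst x b
  | .mul a b =>
      have hlt := c.wf i a b (Or.inr h)
      c.evalGate cst x a * c.evalGate cst x b
termination_by i => i.1
decreasing_by
  · exact hlt.1
  · exact hlt.2
  · exact hlt.1
  · exact hlt.2

/-- The value computed (at the output gate) by a circuit. -/
def eval {R : Type} [CommRing R] (c : Circuit K ν) (cst : K → R) (x : ν → R) : R :=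
  c.evalGate cst x c.output

/-- The polynomial computed by a circuit. -/
noncomputable def evalP [CommRing K] (c : Circuit K ν) : MvPolynomial ν K :=
  c.eval MvPolynomial.C MvPolynomial.X

def depthGate (c : Circuit K ν) : Fin c.size → ℕ := fun i =>
  match h : c.gate i with
  | .const _ => 0
  | .var _ => 0
  | .add a b =>
      have hlt := c.wf i a b (Or.inl h)
      max (c.depthGate a) (c.depthGate b) + 1
  | .mul a b =>
      have hlt := c.wf i a b (Or.inr h)
      max (c.depthGate a) (c.depthGate b) + 1
termination_by i => i.1
decreasing_by
  · exact hlt.1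
  · exact hlt.2
  · exact hlt.1
  · exact hlt.2

/-- Depth of a circuit: length of the longest input-to-output path. -/
def depth (c : Circuit K ν) : ℕ := c.depthGate c.output

/-- A circuit is skew if every multiplication gate has at least one argument
which is an input gate. -/
def IsSkew (c : Circuit K ν) : Prop :=
  ∀ i a b, c.gate i = .mul a b → (c.gate a).IsInput ∨ (c.gate b).IsInput

/-- `arrow j i` : there is an arrow from gate `j` to gate `i`. -/
def arrow (c : Circuit K ν) (j i : Fin c.size) : Prop :=
  ∃ a b, (c.gate i = .add a b ∨ c.gate i = .mul a b) ∧ (j = a ∨ j = b)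

/-- The subcircuit rooted at `g` is connected to the rest of the circuit only through
the arrow from `g` to `i`. -/
def OnlyConn (c : Circuit K ν) (g i : Fin c.size) : Prop :=
  ∀ j, Relation.ReflTransGen c.arrow j g →
    ∀ k, c.arrow j k → Relation.ReflTransGen c.arrow k g ∨ (j = g ∧ k = i)

/-- A circuit is weakly skew if for every multiplication gate, at least one of the incoming
arrows comes from an input gate or from a subcircuit whose only connection to the rest of
the circuit is through this arrow. -/
def IsWeaklySkew (c : Circuit K ν) : Prop :=
  ∀ i a b, c.gate i = .mul a b →
    ((c.gate a).IsInput ∨ c.OnlyConn a i) ∨ ((c.gate b).IsInput ∨ c.OnlyConn b i)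

end Circuit

/-! ### Treewidth -/

/-- `G` admits a tree-decomposition of width at most `k`. -/
def HasTreewidthAtMost {V : Type} (G : SimpleGraph V) (k : ℕ) : Prop :=
  ∃ (n : ℕ) (T : SimpleGraph (Fin n)) (X : Fin n → Finset V),
    T.IsTree ∧
    (∀ t, (X t).card ≤ k + 1) ∧
    (∀ v : V, ∃ t, v ∈ X t) ∧
    (∀ u v : V, G.Adj u v → ∃ t, u ∈ X t ∧ v ∈ X t) ∧
    (∀ v : V, (T.induce {t | v ∈ X t}).Connected)

/-- The underlying undirected simple graph of a digraph (loops discarded). -/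
def underlyingGraph {V : Type} (E : V → V → Prop) : SimpleGraph V :=
  SimpleGraph.fromRel E

/-- The underlying undirected graph of the support digraph `G_M` of a matrix. -/
def supportGraph {m : ℕ} {R : Type} [Zero R] (M : Matrix (Fin m) (Fin m) R) :
    SimpleGraph (Fin m) :=
  SimpleGraph.fromRel (fun i j => M i j ≠ 0)

/-! ### Permanent, hamiltonian, cycle covers -/

/-- The permanent of a square matrix. -/
def perm {m : ℕ} {R : Type} [CommRing R] (M : Matrix (Fin m) (Fin m) R) : R :=
  ∑ σ : Equiv.Perm (Fin m), ∏ i, M i (σ i)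

/-- The hamiltonian polynomial of a square matrix: sum over permutations that are a
single cycle on all of `Fin m`. -/
noncomputable def ham {m : ℕ} {R : Type} [CommRing R] (M : Matrix (Fin m) (Fin m) R) : R :=
  ∑ σ ∈ Finset.univ.filter
      (fun σ : Equiv.Perm (Fin m) => σ.IsCycle ∧ σ.support = Finset.univ),
    ∏ i, M i (σ i)

/-- A cycle cover of the digraph with edge relation `E`: a set of edges of `E` forming
vertex-disjoint directed cycles (loops allowed) covering every vertex exactly once,
i.e. every vertex has exactly one outgoing and exactly one incoming edge in `C`. -/
def IsCycleCover {V : Type} (E : V → V → Prop) (C : Finset (V × V)) : Prop :=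
  (∀ e ∈ C, E e.1 e.2) ∧ (∀ v : V, ∃! u, (v, u) ∈ C) ∧ (∀ v : V, ∃! u, (u, v) ∈ C)

/-- The sum of weights of all cycle covers. -/
noncomputable def cycleCoverSum {V K : Type} [Fintype V] [DecidableEq V] [CommRing K]
    (E : V → V → Prop) (w : V → V → K) : K :=
  ∑ C : Finset (V × V), if IsCycleCover E C then ∏ e ∈ C, w e.1 e.2 else 0

/-! ### Weighted DAGs and path sums -/

/-- The weight of a path (given as the list of its vertices). -/
def pathWeight {V K : Type} [CommRing K] (w : V → V → K) (l : List V) : K :=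
  ((l.zip l.tail).map fun p => w p.1 p.2).prod

/-- `l` is (the vertex list of) a directed path from `s` to `t`. -/
def IsPathFromTo {V : Type} (E : V → V → Prop) (s t : V) (l : List V) : Prop :=
  l.Chain' E ∧ l.head? = some s ∧ l.getLast? = some t

/-- The sum of the weights of all directed paths from `s` to `t`. -/
noncomputable def SW {V K : Type} [Fintype V] [DecidableEq V] [CommRing K]
    (E : V → V → Prop) (w : V → V → K) (s t : V) : K :=
  ∑ l : {l : List V // l.Nodup},
    if IsPathFromTo E s t l.1 then pathWeight w l.1 else 0

/-- A digraph is acyclic if it has no directed cycle (in particular no loop). -/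
def Acyclic {V : Type} (E : V → V → Prop) : Prop :=
  ∀ v : V, ¬ Relation.TransGen E v v

/-! ### Perfect matchings, SPM, planarity -/

/-- `M` is (the edge set of) a perfect matching of `G`. -/
def IsPerfectMatchingSet {V : Type} (G : SimpleGraph V) (M : Finset (Sym2 V)) : Prop :=
  (∀ e ∈ M, e ∈ G.edgeSet) ∧ ∀ v : V, ∃! e, e ∈ M ∧ v ∈ e

/-- The sum of the weights of all perfect matchings of `G`. -/
noncomputable def SPM {V K : Type} [Fintype V] [DecidableEq V] [CommRing K]
    (G : SimpleGraph V) (w : Sym2 V → K) : K :=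
  ∑ M : Finset (Sym2 V), if IsPerfectMatchingSet G M then ∏ e ∈ M, w e else 0

/-- A graph is planar if it has a drawing in the plane: vertices are mapped to distinct
points, edges to simple arcs joining their endpoints, arcs meet vertices only at their
endpoints, and two arcs of distinct edges do not meet except possibly at endpoints. -/
def IsPlanar {V : Type} (G : SimpleGraph V) : Prop :=
  ∃ (f : V → ℝ × ℝ) (γ : ∀ u v : V, G.Adj u v → Path (f u) (f v)),
    Function.Injective f ∧
    (∀ u v h, Function.Injective fun t : unitInterval => (γ u v h) t) ∧
    (∀ u v h (t : unitInterval), t ≠ 0 → t ≠ 1 → ∀ x : V, (γ u v h) t ≠ f x) ∧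
    (∀ u v h u' v' h', s(u, v) ≠ s(u', v') →
      ∀ (t t' : unitInterval), t ≠ 0 → t ≠ 1 → t' ≠ 0 → t' ≠ 1 →
        (γ u v h) t ≠ (γ u' v' h') t')


/-! ### Binary trees of bags -/

/-- Binary trees whose nodes carry bags of vertices. -/
inductive BagTree (V : Type) where
  | nil : BagTree V
  | node : Finset V → BagTree V → BagTree V → BagTree V

namespace BagTree
variable {V : Type}

def bags : BagTree V → Set (Finset V)
  | nil => ∅
  | node X l r => insert X (l.bags ∪ r.bags)

noncomputable def verts : BagTree V → Finset V
  | nil => ∅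
  | node X l r => X ∪ (l.verts ∪ r.verts)

/-- The number of nodes on a longest branch. -/
def height : BagTree V → ℕ
  | nil => 0
  | node _ l r => max l.height r.height + 1

/-- Every vertex occurs in a connected set of bags, and the vertices of `S` which occur at all
occur in the root bag. -/
def Valid : Finset V → BagTree V → Prop
  | _, nil => True
  | S, node X l r => S ∩ (node X l r).verts ⊆ X ∧ Valid X l ∧ Valid X r ∧ l.verts ∩ r.verts ⊆ X

/-- The number of vertices outside `S`, each counted where it first occurs below the root. -/
noncomputable def weight : Finset V → BagTree V → ℕ
  | _, nil => 0
  | S, node X l r => (X \ S).card + l.weight X + r.weight X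

theorem subset_verts {t : BagTree V} {Y : Finset V} (h : Y ∈ t.bags) : Y ⊆ t.verts := by
  induction t with
  | nil => simp [bags] at h
  | node X l r ihl ihr => grind [bags, verts]

theorem Valid.mono {S S' : Finset V} {t : BagTree V} (h : Valid S t) (hS : S' ∩ t.verts ⊆ S) :
    Valid S' t := by
  cases t with
  | nil => trivial
  | node X l r =>
    refine ⟨fun v hv => h.1 ?_, h.2⟩
    grind

theorem verts_subset_of_weight_eq_zero {S : Finset V} {t : BagTree V} (h : t.weight S = 0) :
    t.verts ⊆ S := by
  induction t generalizing S with
  | nil => simp [verts]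
  | node X l r ihl ihr =>
    simp only [weight, Nat.add_eq_zero_iff, Finset.card_eq_zero, Finset.sdiff_eq_empty_iff_subset]
      at h
    have := ihl h.1.2
    have := ihr h.2
    grind [verts]

theorem Valid.weight_le {S : Finset V} {t : BagTree V} (h : Valid S t) :
    t.weight S ≤ (t.verts \ S).card := by
  induction t generalizing S with
  | nil => simp [weight]
  | node X l r ihl ihr =>
    obtain ⟨h1, hl, hr, h2⟩ := h
    have d1 : Disjoint (X \ S) (l.verts \ X) := by
      rw [Finset.disjoint_left]; grind
    have d2 : Disjoint ((X \ S) ∪ (l.verts \ X)) (r.verts \ X) := by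
      rw [Finset.disjoint_left]; grind
    calc weight S (node X l r)
        ≤ (X \ S).card + (l.verts \ X).card + (r.verts \ X).card := by
          have := ihl hl
          have := ihr hr
          simp only [weight]; omega
      _ = (((X \ S) ∪ (l.verts \ X)) ∪ (r.verts \ X)).card := by
          rw [Finset.card_union_of_disjoint d2, Finset.card_union_of_disjoint d1]
      _ ≤ _ := by
          apply Finset.card_le_card
          intro v hv
          have : v ∈ S → v ∈ (node X l r).verts → v ∈ X := fun a b =>
            h1 (Finset.mem_inter.2 ⟨a, b⟩)
          grind [verts]

/-- A new leaf may be attached to any node whose bag contains all old vertices of the new bag. -/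
theorem Valid.exists_attach {S Y Z : Finset V} {t : BagTree V} (h : Valid S t) (hZ : Z ∈ t.bags)
    (hY : Y ∩ (S ∪ t.verts) ⊆ Z) :
    ∃ t' : BagTree V, Valid S t' ∧ t'.bags = insert Y t.bags ∧ t'.verts = Y ∪ t.verts := by
  induction t generalizing S with
  | nil => simp [bags] at hZ
  | node X l r ihl ihr =>
    obtain ⟨h1, hl, hr, h2⟩ := h
    have hZU := subset_verts hZ
    simp only [bags, Set.mem_insert_iff, Set.mem_union] at hZ
    rcases hZ with rfl | hZ | hZ
    · refine ⟨node Z (node Z l r) (node Y nil nil),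
        ⟨?_, ⟨?_, hl, hr, h2⟩, ⟨?_, trivial, trivial, ?_⟩, ?_⟩, ?_, ?_⟩
      · intro v hv
        simp only [verts] at *
        grind
      · grind
      · grind [verts]
      · simp [verts]
      · intro v hv
        simp only [verts] at *
        grind
      · ext W; simp only [bags]; grind
      · ext W; simp only [verts]; grind
    · have := subset_verts hZ
      obtain ⟨t', v1, b1, u1⟩ := ihl hl hZ (by simp only [verts] at *; grind)
      refine ⟨node X t' r, ⟨?_, v1, hr, ?_⟩, ?_, ?_⟩
      · simp only [verts] at *; grind
      · simp only [verts] at *; grind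
      · simp only [bags, b1]; grind
      · simp only [verts, u1]; grind
    · have := subset_verts hZ
      obtain ⟨t', v1, b1, u1⟩ := ihr hr hZ (by simp only [verts] at *; grind)
      refine ⟨node X l t', ⟨?_, hl, v1, ?_⟩, ?_, ?_⟩
      · simp only [verts] at *; grind
      · simp only [verts] at *; grind
      · simp only [bags, b1]; grind
      · simp only [verts, u1]; grind

/-! ### Spines: paths of bags with one tree hanging off each of them -/

def spineBags : List (Finset V × BagTree V) → Set (Finset V)
  | [] => ∅
  | (X, t) :: l => insert X (t.bags ∪ spineBags l)

/-- The vertices of a spine whose last node has an additional child with bag `E`. -/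
noncomputable def spineVerts (E : Finset V) : List (Finset V × BagTree V) → Finset V
  | [] => E
  | (X, t) :: l => X ∪ (t.verts ∪ spineVerts E l)

def SpineValid (E : Finset V) : Finset V → List (Finset V × BagTree V) → Prop
  | _, [] => True
  | S, (X, t) :: l => S ∩ spineVerts E ((X, t) :: l) ⊆ X ∧ Valid X t ∧ SpineValid E X l ∧
      t.verts ∩ spineVerts E l ⊆ X

noncomputable def spineWeight : Finset V → List (Finset V × BagTree V) → ℕ
  | _, [] => 0
  | S, (X, t) :: l => (X \ S).card + t.weight X + spineWeight X l

theorem subset_spineVerts (E : Finset V) (l : List (Finset V × BagTree V)) :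
    E ⊆ spineVerts E l := by
  induction l with
  | nil => simp [spineVerts]
  | cons a l ih => simp only [spineVerts]; grind

theorem spineVerts_subset_of_spineWeight_eq_zero {S E : Finset V}
    {l : List (Finset V × BagTree V)} (h : spineWeight S l = 0) : spineVerts E l ⊆ S ∪ E := by
  induction l generalizing S with
  | nil => simp [spineVerts]
  | cons a l ih =>
    simp only [spineWeight, Nat.add_eq_zero_iff, Finset.card_eq_zero,
      Finset.sdiff_eq_empty_iff_subset] at h
    have := ih h.2
    have := verts_subset_of_weight_eq_zero h.1.2
    simp only [spineVerts]
    grind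

theorem subset_spineVerts_of_mem {E Y : Finset V} {l : List (Finset V × BagTree V)}
    (h : Y ∈ spineBags l) : Y ⊆ spineVerts E l := by
  induction l with
  | nil => simp [spineBags] at h
  | cons a l ih =>
    have := @subset_verts V a.2 Y
    simp only [spineVerts]
    grind [spineBags]

/-- Cutting a spine at a node such that neither of the two remaining spines is heavy. -/
theorem SpineValid.exists_split {S E : Finset V} {l : List (Finset V × BagTree V)}
    (h : SpineValid E S l) (hl : l ≠ []) (N : ℕ) :
    ∃ a X t b, SpineValid X S a ∧ Valid X t ∧ SpineValid E X b ∧ t.verts ∩ spineVerts E b ⊆ X ∧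
      spineVerts X a ∩ (t.verts ∪ spineVerts E b) ⊆ X ∧ S ∩ (t.verts ∪ spineVerts E b) ⊆ X ∧
      spineVerts E l = spineVerts X a ∪ (t.verts ∪ spineVerts E b) ∧
      spineBags l = insert X (spineBags a ∪ (t.bags ∪ spineBags b)) ∧
      t.weight X ≤ spineWeight S l ∧ 2 * spineWeight X b ≤ N ∧
      (2 * spineWeight S a + N ≤ 2 * spineWeight S l ∨ spineWeight S a = 0) := by
  induction l generalizing S with
  | nil => exact absurd rfl hl
  | cons c l ih =>
    obtain ⟨Y, s⟩ := c
    obtain ⟨h1, hs, hv, h2⟩ := h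
    by_cases hw : 2 * spineWeight Y l ≤ N
    · refine ⟨[], Y, s, l, trivial, hs, hv, h2, by simp [spineVerts], ?_, by simp [spineVerts],
        by simp [spineBags], ?_, hw, Or.inr rfl⟩
      · simp only [spineVerts] at h1; grind
      · simp only [spineWeight]; omega
    · have hl' : l ≠ [] := by
        rintro rfl
        simp [spineWeight] at hw
      obtain ⟨a, X, t, b, ha, ht, hb, h3, h4, h5, h6, h7, h8, h9, h10⟩ := ih hv hl'
      have hXa := subset_spineVerts X a
      refine ⟨(Y, s) :: a, X, t, b, ⟨?_, hs, ha, ?_⟩, ht, hb, h3, ?_, ?_, ?_, ?_, ?_, h9, Or.inl ?_⟩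
      · simp only [spineVerts, h6] at *; grind
      · simp only [h6] at *; grind
      · simp only [spineVerts, h6] at *; grind
      · simp only [spineVerts, h6] at *; grind
      · simp only [spineVerts, h6] at *; grind
      · simp only [spineBags, h7]; grind
      · simp only [spineWeight]; omega
      · simp only [spineWeight]; omega

/-- Following a path of heavy subtrees until none of the subtrees below it is heavy. -/
theorem Valid.exists_split {S : Finset V} {t : BagTree V} (h : Valid S t) (ht : t ≠ nil) (N : ℕ) :
    ∃ a X l r, SpineValid X S a ∧ Valid X l ∧ Valid X r ∧ l.verts ∩ r.verts ⊆ X ∧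
      spineVerts X a ∩ (l.verts ∪ r.verts) ⊆ X ∧ S ∩ (l.verts ∪ r.verts) ⊆ X ∧
      t.verts = spineVerts X a ∪ (l.verts ∪ r.verts) ∧
      t.bags = insert X (spineBags a ∪ (l.bags ∪ r.bags)) ∧
      2 * l.weight X ≤ N ∧ 2 * r.weight X ≤ N ∧
      (2 * spineWeight S a + N ≤ 2 * t.weight S ∨ spineWeight S a = 0) := by
  induction t generalizing S with
  | nil => exact absurd rfl ht
  | node Y p q ihp ihq =>
    obtain ⟨h1, hp, hq, h2⟩ := h
    by_cases hwp : 2 * p.weight Y ≤ N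
    · by_cases hwq : 2 * q.weight Y ≤ N
      · refine ⟨[], Y, p, q, trivial, hp, hq, h2, by simp [spineVerts], ?_,
          by simp [spineVerts, verts], by simp [spineBags, bags], hwp, hwq, Or.inr rfl⟩
        simp only [verts] at h1; grind
      · have hq' : q ≠ nil := by
          rintro rfl
          simp [weight] at hwq
        obtain ⟨a, X, l, r, ha, hl, hr, h3, h4, h5, h6, h7, h8, h9, h10⟩ := ihq hq hq'
        have hXa := subset_spineVerts X a
        refine ⟨(Y, p) :: a, X, l, r, ⟨?_, hp, ha, ?_⟩, hl, hr, h3, ?_, ?_, ?_, ?_, h8, h9,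
          Or.inl ?_⟩
        · simp only [spineVerts, verts, h6] at *; grind
        · simp only [h6] at *; grind
        · simp only [spineVerts, verts, h6] at *; grind
        · simp only [verts, h6] at *; grind
        · simp only [spineVerts, verts, h6] at *; grind
        · simp only [spineBags, bags, h7]; grind
        · simp only [spineWeight, weight]; omega
    · have hp' : p ≠ nil := by
        rintro rfl
        simp [weight] at hwp
      obtain ⟨a, X, l, r, ha, hl, hr, h3, h4, h5, h6, h7, h8, h9, h10⟩ := ihp hp hp'
      have hXa := subset_spineVerts X a
      refine ⟨(Y, q) :: a, X, l, r, ⟨?_, hq, ha, ?_⟩, hl, hr, h3, ?_, ?_, ?_, ?_, h8, h9,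
        Or.inl ?_⟩
      · simp only [spineVerts, verts, h6] at *; grind
      · simp only [h6] at *; grind
      · simp only [spineVerts, verts, h6] at *; grind
      · simp only [verts, h6] at *; grind
      · simp only [spineVerts, verts, h6] at *; grind
      · simp only [spineBags, bags, h7]; grind
      · simp only [spineWeight, weight]; omega

/-! ### Balancing -/

/-- There is a valid tree of height at most `d + 1` with bags of size at most `m`, using only
vertices of `U ∪ S`, with `S` as boundary, whose bags cover all members of `F`. -/
def HasTree (m : ℕ) (S U : Finset V) (F : Set (Finset V)) (d : ℕ) : Prop :=
  ∃ t : BagTree V, Valid S t ∧ t.verts ⊆ U ∪ S ∧ (∀ Y ∈ F, ∃ Z ∈ t.bags, Y ⊆ Z) ∧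
    (∀ Z ∈ t.bags, Z.card ≤ m) ∧ t.height ≤ d + 1

theorem hasTree_of_subset {m : ℕ} {S U : Finset V} {F : Set (Finset V)} (d : ℕ)
    (hS : S.card ≤ m) (hF : ∀ Y ∈ F, Y ⊆ S) : HasTree m S U F d :=
  ⟨node S nil nil, ⟨by grind, trivial, trivial, by simp [verts]⟩, by simp [verts],
    fun Y hY => ⟨S, by simp [bags], hF Y hY⟩, by simp [bags, hS], by simp [height]⟩

theorem HasTree.combine {m d : ℕ} {S S₁ S₂ U₁ U₂ U B : Finset V} {F₁ F₂ F : Set (Finset V)}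
    (h₁ : HasTree m S₁ U₁ F₁ d) (h₂ : HasTree m S₂ U₂ F₂ d) (hB : B.card ≤ m)
    (hS : S ⊆ B) (hS₁ : S₁ ⊆ B) (hS₂ : S₂ ⊆ B) (hBU₁ : B ∩ U₁ ⊆ S₁) (hBU₂ : B ∩ U₂ ⊆ S₂)
    (hU : U₁ ∩ U₂ ⊆ B) (hBU : B ⊆ U ∪ S) (hU₁ : U₁ ⊆ U) (hU₂ : U₂ ⊆ U)
    (hF : ∀ Y ∈ F, Y ⊆ B ∨ Y ∈ F₁ ∨ Y ∈ F₂) :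
    HasTree m S U F (d + 1) := by
  obtain ⟨t₁, v₁, u₁, c₁, b₁, e₁⟩ := h₁
  obtain ⟨t₂, v₂, u₂, c₂, b₂, e₂⟩ := h₂
  refine ⟨node B t₁ t₂, ⟨?_, v₁.mono ?_, v₂.mono ?_, ?_⟩, ?_, ?_, ?_, ?_⟩
  · grind
  · grind
  · grind
  · grind
  · simp only [verts]; grind
  · intro Y hY
    rcases hF Y hY with h | h | h
    · exact ⟨B, by simp [bags], h⟩
    · obtain ⟨Z, hZ, hYZ⟩ := c₁ Y h
      exact ⟨Z, by simp [bags, hZ], hYZ⟩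
    · obtain ⟨Z, hZ, hYZ⟩ := c₂ Y h
      exact ⟨Z, by simp [bags, hZ], hYZ⟩
  · simp only [bags]; grind
  · simp only [height]; omega

theorem HasTree.mono {m d d' : ℕ} {S U : Finset V} {F : Set (Finset V)} (h : HasTree m S U F d)
    (hd : d ≤ d') : HasTree m S U F d' := by
  obtain ⟨t, v, u, c, b, e⟩ := h
  exact ⟨t, v, u, c, b, by omega⟩

theorem hasTree_of_weight_succ {c d N : ℕ} {S : Finset V} {t : BagTree V} (h : Valid S t)
    (hS : S.card ≤ c) (hc : ∀ Y ∈ t.bags, Y.card ≤ c) (hw : t.weight S ≤ N)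
    (tree : ∀ (S : Finset V) (t : BagTree V), Valid S t → S.card ≤ c → (∀ Y ∈ t.bags, Y.card ≤ c) →
      2 * t.weight S ≤ N → HasTree (3 * c) S t.verts t.bags d)
    (spine : ∀ (S E : Finset V) (l : List (Finset V × BagTree V)), SpineValid E S l →
      S.card ≤ c → E.card ≤ c → (∀ Y ∈ spineBags l, Y.card ≤ c) → 2 * spineWeight S l ≤ N →
      HasTree (3 * c) (S ∪ E) (spineVerts E l) (spineBags l) (d + 1)) :
    HasTree (3 * c) S t.verts t.bags (d + 2) := by
  by_cases ht : t = nil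
  · subst ht
    exact hasTree_of_subset _ (by omega) (by simp [bags])
  obtain ⟨a, X, l, r, ha, hl, hr, h3, h4, h5, h6, h7, h8, h9, h10⟩ := h.exists_split ht N
  have hX : X.card ≤ c := hc X (by simp [h7])
  have hXa := subset_spineVerts X a
  have Hl := tree X l hl hX (fun Y hY => hc Y (by simp [h7, hY])) h8
  have Hr := tree X r hr hX (fun Y hY => hc Y (by simp [h7, hY])) h9
  have Ha := spine S X a ha hS hX (fun Y hY => hc Y (by simp [h7, hY])) (by omega)
  have Hlr : HasTree (3 * c) X (X ∪ (l.verts ∪ r.verts)) (l.bags ∪ r.bags) (d + 1) :=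
    Hl.combine (B := X) Hr (by omega) subset_rfl subset_rfl subset_rfl Finset.inter_subset_left
      Finset.inter_subset_left h3 (by grind) (by grind) (by grind) (by grind)
  have hcard := Finset.card_union_le S X
  refine Ha.combine (B := S ∪ X) Hlr (by omega) (by grind) (by grind) (by grind) (by grind)
    (by grind) (by grind) (by grind) (by grind) (by grind) ?_
  intro Y hY
  rw [h7] at hY
  grind

theorem hasTree_of_spineWeight_succ {c d N : ℕ} {S E : Finset V}
    {l : List (Finset V × BagTree V)} (h : SpineValid E S l)
    (hS : S.card ≤ c) (hE : E.card ≤ c) (hc : ∀ Y ∈ spineBags l, Y.card ≤ c)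
    (hw : spineWeight S l ≤ N)
    (tree : ∀ (S : Finset V) (t : BagTree V), Valid S t → S.card ≤ c → (∀ Y ∈ t.bags, Y.card ≤ c) →
      t.weight S ≤ N → HasTree (3 * c) S t.verts t.bags d)
    (spine : ∀ (S E : Finset V) (l : List (Finset V × BagTree V)), SpineValid E S l →
      S.card ≤ c → E.card ≤ c → (∀ Y ∈ spineBags l, Y.card ≤ c) → 2 * spineWeight S l ≤ N →
      HasTree (3 * c) (S ∪ E) (spineVerts E l) (spineBags l) d) :
    HasTree (3 * c) (S ∪ E) (spineVerts E l) (spineBags l) (d + 2) := by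
  by_cases hl : l = []
  · subst hl
    have hcard := Finset.card_union_le S E
    exact hasTree_of_subset _ (by omega) (by simp [spineBags])
  obtain ⟨a, X, t, b, ha, ht, hb, h3, h4, h5, h6, h7, h8, h9, h10⟩ := h.exists_split hl N
  have hX : X.card ≤ c := hc X (by simp [h7])
  have hXa := subset_spineVerts X a
  have hEb := subset_spineVerts E b
  have Ha := spine S X a ha hS hX (fun Y hY => hc Y (by simp [h7, hY])) (by omega)
  have Hb := spine X E b hb hX hE (fun Y hY => hc Y (by simp [h7, hY])) h9
  have Ht := tree X t ht hX (fun Y hY => hc Y (by simp [h7, hY])) (by omega)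
  have hcard := Finset.card_union_le X E
  have hcard' := Finset.card_union_le S (X ∪ E)
  have Htb : HasTree (3 * c) (X ∪ E) (X ∪ (t.verts ∪ spineVerts E b)) (t.bags ∪ spineBags b)
      (d + 1) :=
    Ht.combine (B := X ∪ E) Hb (by omega) (by grind) (by grind) (by grind) (by grind)
      (by grind) (by grind) (by grind) (by grind) (by grind) (by grind)
  refine (Ha.mono (Nat.le_succ d)).combine (B := S ∪ (X ∪ E)) Htb (by omega) (by grind) (by grind)
    (by grind) (by grind) (by grind) (by grind) (by grind) (by grind) (by grind) ?_
  intro Y hY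
  rw [h7] at hY
  grind

theorem hasTree_of_weight_lt {c : ℕ} (j : ℕ) :
    (∀ (S : Finset V) (t : BagTree V), Valid S t → S.card ≤ c → (∀ Y ∈ t.bags, Y.card ≤ c) →
      t.weight S < 2 ^ j → HasTree (3 * c) S t.verts t.bags (4 * j)) ∧
    (∀ (S E : Finset V) (l : List (Finset V × BagTree V)), SpineValid E S l →
      S.card ≤ c → E.card ≤ c → (∀ Y ∈ spineBags l, Y.card ≤ c) → spineWeight S l < 2 ^ j →
      HasTree (3 * c) (S ∪ E) (spineVerts E l) (spineBags l) (4 * j + 2)) := by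
  induction j with
  | zero =>
    refine ⟨fun S t _ hS _ hw => ?_, fun S E l _ hS hE _ hw => ?_⟩
    · have := verts_subset_of_weight_eq_zero (S := S) (t := t) (by simpa using hw)
      exact hasTree_of_subset _ (by omega) fun Y hY => (subset_verts hY).trans this
    · have := spineVerts_subset_of_spineWeight_eq_zero (S := S) (E := E) (l := l) (by simpa using hw)
      have hcard := Finset.card_union_le S E
      exact hasTree_of_subset _ (by omega) fun Y hY => (subset_spineVerts_of_mem hY).trans this
  | succ j ih =>
    obtain ⟨iht, ihs⟩ := ih
    rw [pow_succ]
    have tree : ∀ (S : Finset V) (t : BagTree V), Valid S t → S.card ≤ c →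
        (∀ Y ∈ t.bags, Y.card ≤ c) → t.weight S < 2 ^ j * 2 →
        HasTree (3 * c) S t.verts t.bags (4 * (j + 1)) := by
      intro S t h hS hc hw
      exact hasTree_of_weight_succ (d := 4 * j + 2) (N := 2 ^ j * 2 - 1) h hS hc (by omega)
        (fun S t h hS hc hw => (iht S t h hS hc (by omega)).mono (by omega))
        (fun S E l h hS hE hc hw => (ihs S E l h hS hE hc (by omega)).mono (by omega))
    refine ⟨tree, fun S E l h hS hE hc hw => ?_⟩
    exact hasTree_of_spineWeight_succ (d := 4 * (j + 1)) (N := 2 ^ j * 2 - 1) h hS hE hc (by omega)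
      (fun S t h hS hc hw => tree S t h hS hc (by omega))
      (fun S E l h hS hE hc hw => (ihs S E l h hS hE hc (by omega)).mono (by omega))

/-! ### Positions in a tree of bags -/

/-- The bag at the position reached from the root by a list of left (`false`) and right (`true`)
turns, empty if there is no such node. -/
def bagAt : BagTree V → List Bool → Finset V
  | nil, _ => ∅
  | node X _ _, [] => X
  | node _ l _, false :: p => l.bagAt p
  | node _ _ r, true :: p => r.bagAt p

theorem bagAt_subset_verts (t : BagTree V) (p : List Bool) : t.bagAt p ⊆ t.verts := by
  induction t generalizing p with
  | nil => simp [bagAt]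
  | node X l r ihl ihr =>
    rcases p with _ | ⟨_ | _, p⟩
    · simp [bagAt, verts]
    · have := ihl p; simp only [bagAt, verts]; grind
    · have := ihr p; simp only [bagAt, verts]; grind

theorem bagAt_eq_empty_or_mem (t : BagTree V) (p : List Bool) :
    t.bagAt p = ∅ ∨ t.bagAt p ∈ t.bags := by
  induction t generalizing p with
  | nil => simp [bagAt]
  | node X l r ihl ihr =>
    rcases p with _ | ⟨_ | _, p⟩
    · simp [bagAt, bags]
    · have := ihl p; simp only [bagAt, bags]; grind
    · have := ihr p; simp only [bagAt, bags]; grind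

theorem length_lt_height {t : BagTree V} {p : List Bool} {v : V} (h : v ∈ t.bagAt p) :
    p.length < t.height := by
  induction t generalizing p with
  | nil => simp [bagAt] at h
  | node X l r ihl ihr =>
    rcases p with _ | ⟨_ | _, p⟩
    · simp [height]
    · have := ihl h; simp only [height, List.length_cons]; omega
    · have := ihr h; simp only [height, List.length_cons]; omega

theorem exists_bagAt_eq {t : BagTree V} {Z : Finset V} (h : Z ∈ t.bags) : ∃ p, t.bagAt p = Z := by
  induction t with
  | nil => simp [bags] at h
  | node X l r ihl ihr =>
    simp only [bags, Set.mem_insert_iff, Set.mem_union] at h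
    rcases h with rfl | h | h
    · exact ⟨[], rfl⟩
    · obtain ⟨p, hp⟩ := ihl h; exact ⟨false :: p, hp⟩
    · obtain ⟨p, hp⟩ := ihr h; exact ⟨true :: p, hp⟩

/-- The positions of the bags containing `v` have a topmost element. -/
theorem Valid.exists_top {S : Finset V} {t : BagTree V} (h : Valid S t) {v : V}
    (hv : v ∈ t.verts) :
    ∃ p₀, v ∈ t.bagAt p₀ ∧ (v ∈ S → p₀ = []) ∧
      ∀ p, v ∈ t.bagAt p → p ≠ p₀ → p ≠ [] ∧ v ∈ t.bagAt p.dropLast := by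
  induction t generalizing S with
  | nil => simp [verts] at hv
  | node X l r ihl ihr =>
    obtain ⟨h1, hl, hr, h2⟩ := h
    have hSX : v ∈ S → v ∈ X := fun hS => h1 (Finset.mem_inter.2 ⟨hS, hv⟩)
    have hlr : v ∈ l.verts → v ∈ r.verts → v ∈ X := fun a b => h2 (Finset.mem_inter.2 ⟨a, b⟩)
    by_cases hX : v ∈ X
    · refine ⟨[], hX, fun _ => rfl, ?_⟩
      rintro (_ | ⟨_ | _, _ | ⟨b, p⟩⟩) hp hne
      · exact absurd rfl hne
      · exact ⟨by simp, hX⟩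
      · obtain ⟨q, -, hq, H⟩ := ihl hl (bagAt_subset_verts _ _ hp)
        exact ⟨by simp, (H _ hp (by simp [hq hX])).2⟩
      · exact ⟨by simp, hX⟩
      · obtain ⟨q, -, hq, H⟩ := ihr hr (bagAt_subset_verts _ _ hp)
        exact ⟨by simp, (H _ hp (by simp [hq hX])).2⟩
    · simp only [verts, Finset.mem_union, hX, false_or] at hv
      rcases hv with hv | hv
      · obtain ⟨q, hq, -, H⟩ := ihl hl hv
        refine ⟨false :: q, hq, fun hS => absurd (hSX hS) hX, ?_⟩
        rintro (_ | ⟨_ | _, p⟩) hp hne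
        · exact absurd hp hX
        · obtain ⟨hne', hm⟩ := H p hp (by simpa using hne)
          refine ⟨by simp, ?_⟩
          rwa [List.dropLast_cons_of_ne_nil hne']
        · exact absurd (hlr hv (bagAt_subset_verts _ _ hp)) hX
      · obtain ⟨q, hq, -, H⟩ := ihr hr hv
        refine ⟨true :: q, hq, fun hS => absurd (hSX hS) hX, ?_⟩
        rintro (_ | ⟨_ | _, p⟩) hp hne
        · exact absurd hp hX
        · exact absurd (hlr (bagAt_subset_verts _ _ hp) hv) hX
        · obtain ⟨hne', hm⟩ := H p hp (by simpa using hne)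
          refine ⟨by simp, ?_⟩
          rwa [List.dropLast_cons_of_ne_nil hne']

end BagTree

/-! ### Rooted trees given by parent pointers -/

/-- The graph in which every node other than `r` is joined to its parent. -/
def parentGraph {ι : Type*} (par : ι → ι) (r : ι) : SimpleGraph ι :=
  SimpleGraph.fromRel fun t u => t ≠ r ∧ par t = u

section parentGraph

variable {ι : Type*} {par : ι → ι} {r : ι} {d : ι → ℕ}

theorem parentGraph_adj_par (hd : ∀ t, t ≠ r → d (par t) + 1 = d t) {t : ι} (ht : t ≠ r) :
    (parentGraph par r).Adj t (par t) := by
  refine ⟨fun h => ?_, Or.inl ⟨ht, rfl⟩⟩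
  have := hd t ht
  rw [← h] at this
  omega

theorem parentGraph_induce_connected (hd : ∀ t, t ≠ r → d (par t) + 1 = d t) {s : Set ι} {a : ι}
    (ha : a ∈ s) (hs : ∀ t ∈ s, t ≠ a → t ≠ r ∧ par t ∈ s) :
    ((parentGraph par r).induce s).Connected := by
  have key : ∀ n, ∀ t (ht : t ∈ s), d t = n →
      ((parentGraph par r).induce s).Reachable ⟨t, ht⟩ ⟨a, ha⟩ := by
    intro n
    induction n using Nat.strong_induction_on with
    | _ n ih =>
      intro t ht hn
      by_cases hta : t = a
      · subst hta; rfl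
      · obtain ⟨h1, h2⟩ := hs t ht hta
        have h3 := hd t h1
        refine SimpleGraph.Reachable.trans (SimpleGraph.Adj.reachable ?_)
          (ih (d (par t)) (by omega) (par t) h2 rfl)
        exact parentGraph_adj_par hd h1
  rw [SimpleGraph.connected_iff_exists_forall_reachable]
  exact ⟨⟨a, ha⟩, fun t => (key _ t.1 t.2 rfl).symm⟩

theorem parentGraph_exists_walk (hd : ∀ t, t ≠ r → d (par t) + 1 = d t) (hr : d r = 0) (t : ι) :
    ∃ p : (parentGraph par r).Walk r t, p.length = d t := by
  induction h : d t generalizing t with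
  | zero =>
    have : t = r := by
      by_contra ht
      have := hd t ht
      omega
    subst this
    exact ⟨SimpleGraph.Walk.nil, rfl⟩
  | succ n ih =>
    have ht : t ≠ r := by
      rintro rfl
      omega
    obtain ⟨p, hp⟩ := ih (par t) (by have := hd t ht; omega)
    exact ⟨p.concat (parentGraph_adj_par hd ht).symm, by simp [hp]⟩

theorem parentGraph_dist (hd : ∀ t, t ≠ r → d (par t) + 1 = d t) (hr : d r = 0) (t : ι) :
    (parentGraph par r).dist r t = d t := by
  obtain ⟨p, hp⟩ := parentGraph_exists_walk hd hr t
  apply le_antisymm (hp ▸ SimpleGraph.dist_le p)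
  have key : ∀ {u v : ι} (q : (parentGraph par r).Walk u v), d v ≤ d u + q.length := by
    intro u v q
    induction q with
    | nil => simp
    | @cons x y z h q ih =>
      have : d y ≤ d x + 1 := by
        rcases h.2 with ⟨h1, rfl⟩ | ⟨h1, rfl⟩
        · have := hd _ h1; omega
        · have := hd _ h1; omega
      simp only [SimpleGraph.Walk.length_cons]
      omega
  obtain ⟨q, hq⟩ := p.reachable.exists_walk_length_eq_dist
  have := key q
  omega

theorem parentGraph_connected (hd : ∀ t, t ≠ r → d (par t) + 1 = d t) (hr : d r = 0) :
    (parentGraph par r).Connected := by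
  rw [SimpleGraph.connected_iff_exists_forall_reachable]
  exact ⟨r, fun t => (parentGraph_exists_walk hd hr t).choose.reachable⟩

theorem parentGraph_isTree [Finite ι] (hd : ∀ t, t ≠ r → d (par t) + 1 = d t) (hr : d r = 0) :
    (parentGraph par r).IsTree := by
  have hc := parentGraph_connected hd hr
  refine (SimpleGraph.isTree_iff_connected_and_card).2
    ⟨hc, le_antisymm ?_ hc.card_vert_le_card_edgeSet_add_one⟩
  have hsub : (parentGraph par r).edgeSet ⊆ (fun t => s(t, par t)) '' {t | t ≠ r} := by
    intro e
    induction e with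
    | _ x y =>
      rintro ⟨-, ⟨h, h'⟩ | ⟨h, h'⟩⟩
      · exact ⟨x, h, congrArg (fun z => s(x, z)) h'⟩
      · exact ⟨y, h, (congrArg (fun z => s(y, z)) h').trans Sym2.eq_swap⟩
  have h1 := (Set.ncard_le_ncard hsub (Set.toFinite _)).trans (Set.ncard_image_le (Set.toFinite _))
  have h2 := Set.ncard_add_ncard_compl ({r} : Set ι)
  have h3 : ({t | t ≠ r} : Set ι) = {r}ᶜ := rfl
  rw [h3] at h1
  rw [Set.ncard_singleton] at h2
  rw [Nat.card_coe_set_eq]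
  omega

theorem parentGraph_children_subset (hd : ∀ t, t ≠ r → d (par t) + 1 = d t) (hr : d r = 0) (t : ι) :
    {u | (parentGraph par r).Adj t u ∧
      (parentGraph par r).dist r u = (parentGraph par r).dist r t + 1} ⊆
        {u | u ≠ r ∧ par u = t} := by
  rintro u ⟨⟨-, h | h⟩, hdist⟩
  · rw [parentGraph_dist hd hr, parentGraph_dist hd hr] at hdist
    have := hd t h.1
    rw [h.2] at this
    omega
  · exact h

end parentGraph

/-- A valid tree of bags yields a tree-decomposition over a complete binary tree. -/
theorem BagTree.Valid.exists_decomposition {V : Type} {t : BagTree V} {D : ℕ} (h : t.Valid ∅)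
    (hD : t.height ≤ D + 1) :
    ∃ (n : ℕ) (T : SimpleGraph (Fin n)) (X : Fin n → Finset V) (r : Fin n),
      T.IsTree ∧ (∀ i, X i = ∅ ∨ X i ∈ t.bags) ∧
      (∀ Z ∈ t.bags, Z.Nonempty → ∃ i, X i = Z) ∧
      (∀ v ∈ t.verts, (T.induce {i | v ∈ X i}).Connected) ∧
      (∀ i, {u | T.Adj i u ∧ T.dist r u = T.dist r i + 1}.ncard ≤ 2) ∧
      (∀ i, T.dist r i ≤ D) := by
  have hfin : Finite {p : List Bool | p.length ≤ D} := List.finite_length_le Bool D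
  obtain ⟨n, ⟨e⟩⟩ := Finite.exists_equiv_fin {p : List Bool | p.length ≤ D}
  let r : Fin n := e ⟨[], by simp⟩
  let par : Fin n → Fin n := fun i =>
    e ⟨(e.symm i).1.dropLast, by
      have := (e.symm i).2
      simp only [Set.mem_ofPred_eq] at this ⊢
      simp only [List.length_dropLast]
      omega⟩
  let d : Fin n → ℕ := fun i => (e.symm i).1.length
  have hne : ∀ {i}, i ≠ r → (e.symm i).1 ≠ [] := by
    intro i hi h0
    exact hi (e.symm_apply_eq.1 (Subtype.ext h0))
  have hd : ∀ i, i ≠ r → d (par i) + 1 = d i := by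
    intro i hi
    have := List.length_pos_iff.2 (hne hi)
    simp only [d, par, Equiv.symm_apply_apply, List.length_dropLast]
    omega
  have hr : d r = 0 := by simp [d, r]
  refine ⟨n, parentGraph par r, fun i => t.bagAt (e.symm i).1, r, parentGraph_isTree hd hr,
    fun i => t.bagAt_eq_empty_or_mem _, ?_, ?_, ?_, ?_⟩
  · rintro Z hZ ⟨v, hv⟩
    obtain ⟨p, rfl⟩ := exists_bagAt_eq hZ
    have := length_lt_height hv
    exact ⟨e ⟨p, by simp only [Set.mem_ofPred_eq]; omega⟩, by simp⟩
  · intro v hv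
    obtain ⟨p, hp, -, H⟩ := h.exists_top hv
    have := length_lt_height hp
    refine parentGraph_induce_connected hd (a := e ⟨p, by simp only [Set.mem_ofPred_eq]; omega⟩)
      (by simpa using hp) fun i hi hia => ?_
    obtain ⟨h1, h2⟩ := H _ hi (by
      rintro rfl
      exact hia (by simp))
    refine ⟨?_, by simpa [par] using h2⟩
    rintro rfl
    simp [r] at h1
  · intro i
    refine (Set.ncard_le_ncard (parentGraph_children_subset hd hr i) (Set.toFinite _)).trans ?_
    refine (Set.ncard_le_ncard_of_injOn (t := {some false, some true})
      (fun u => (e.symm u).1.getLast?) ?_ ?_ (Set.toFinite _)).trans (Set.ncard_pair (by simp)).le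
    · rintro u ⟨hu, -⟩
      rw [List.getLast?_eq_some_getLast (hne hu)]
      rcases (e.symm u).1.getLast (hne hu) <;> simp
    · rintro u ⟨hu, hui⟩ w ⟨hw, hwi⟩ huw
      have h1 : (e.symm u).1.dropLast = (e.symm w).1.dropLast := by
        have := hui.trans hwi.symm
        simpa [par] using this
      apply e.symm.injective
      apply Subtype.ext
      simp only [List.getLast?_eq_some_getLast (hne hu), List.getLast?_eq_some_getLast (hne hw),
        Option.some.injEq] at huw
      rw [← List.dropLast_append_getLast (hne hu), ← List.dropLast_append_getLast (hne hw), h1, huw]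
  · intro i
    rw [parentGraph_dist hd hr]
    exact (e.symm i).2

/-! ### From tree-decompositions to trees of bags -/

section

variable {V : Type} {ι : Type*} {T : SimpleGraph ι} {X : ι → Finset V}

theorem SimpleGraph.IsTree.mem_bag_of_adj (hT : T.IsTree)
    (hX : ∀ v : V, (T.induce {t | v ∈ X t}).Connected) {A : Set ι} (hA : (T.induce A).Connected)
    {a p q : ι} (ha : a ∈ A) (hp : p ∈ A) (hq : q ∉ A) (hpq : T.Adj p q) {v : V}
    (hva : v ∈ X a) (hvq : v ∈ X q) : v ∈ X p := by
  by_contra hvp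
  have hb := SimpleGraph.isAcyclic_iff_forall_adj_isBridge.1 hT.isAcyclic hpq
  rw [SimpleGraph.isBridge_iff] at hb
  have key : ∀ {B : Set ι} (x y : ι) (hx : x ∈ B) (hy : y ∈ B), (T.induce B).Connected →
      (p ∉ B ∨ q ∉ B) → (T \ fromEdgeSet {s(p, q)}).Reachable x y := by
    intro B x y hx hy hB hpB
    let f : T.induce B →g (T \ fromEdgeSet {s(p, q)}) :=
      { toFun := Subtype.val
        map_rel' := by
          rintro ⟨b, hb⟩ ⟨c, hc⟩ hbc
          refine ⟨hbc, ?_⟩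
          simp only [fromEdgeSet_adj, Set.mem_singleton_iff, Sym2.eq_iff]
          grind }
    exact (hB.preconnected ⟨x, hx⟩ ⟨y, hy⟩).map f
  exact hb ((key p a hp ha hA (Or.inr hq)).trans
    (key (B := {t | v ∈ X t}) a q hva hvq (hX v) (Or.inl hvp)))

theorem SimpleGraph.IsTree.exists_bagTree_of_card [Fintype ι] (hT : T.IsTree)
    (hX : ∀ v : V, (T.induce {t | v ∈ X t}).Connected) (m : ℕ) (hm : m < Fintype.card ι) :
    ∃ (A : Finset ι) (t : BagTree V), A.card = m + 1 ∧ (T.induce (A : Set ι)).Connected ∧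
      t.Valid ∅ ∧ t.bags = X '' A ∧ t.verts = A.biUnion X := by
  induction m with
  | zero =>
    obtain ⟨r⟩ := hT.connected.nonempty
    refine ⟨{r}, .node (X r) .nil .nil, by simp, ?_,
      ⟨by simp, trivial, trivial, by simp [BagTree.verts]⟩, ?_, ?_⟩
    · have : Subsingleton ((({r} : Finset ι) : Set ι)) := by simp
      have : Nonempty ((({r} : Finset ι) : Set ι)) := ⟨⟨r, by simp⟩⟩
      exact SimpleGraph.Connected.of_subsingleton
    · ext; simp [BagTree.bags]
    · simp [BagTree.verts]
  | succ m ih =>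
    obtain ⟨A, t, hc, hA, ht, hb, hv⟩ := ih (by omega)
    obtain ⟨a, ha⟩ : A.Nonempty := Finset.card_pos.1 (by omega)
    obtain ⟨b, hb'⟩ : ∃ b, b ∉ A := by
      by_contra! hall
      rw [Finset.eq_univ_of_forall hall, Finset.card_univ] at hc
      omega
    obtain ⟨w⟩ := hT.connected.preconnected a b
    obtain ⟨⟨⟨p, q⟩, hpq⟩, -, hp, hq⟩ := w.exists_boundary_dart (A : Set ι) ha hb'
    simp only at hp hq
    have hint : X q ∩ (∅ ∪ t.verts) ⊆ X p := by
      intro v hvq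
      simp only [hv, Finset.mem_inter, Finset.mem_union, Finset.mem_biUnion] at hvq
      obtain ⟨h1, h2 | ⟨c, hcA, h2⟩⟩ := hvq
      · simp at h2
      · exact hT.mem_bag_of_adj hX hA (Finset.mem_coe.2 hcA) hp hq hpq h2 h1
    obtain ⟨t', ht', hb2, hv2⟩ := ht.exists_attach (by rw [hb]; exact ⟨p, hp, rfl⟩) hint
    refine ⟨insert q A, t', ?_, ?_, ht', ?_, ?_⟩
    · rw [Finset.card_insert_of_notMem hq, hc]
    · have : ((insert q A : Finset ι) : Set ι) = (A : Set ι) ∪ {p, q} := by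
        ext x; simp only [Finset.coe_insert]; grind
      rw [this]
      exact SimpleGraph.induce_union_connected hA.preconnected
        (SimpleGraph.induce_pair_connected_of_adj hpq).preconnected ⟨p, hp, by simp⟩
    · rw [hb2, hb, Finset.coe_insert, Set.image_insert_eq]
    · rw [hv2, hv, Finset.biUnion_insert]

theorem SimpleGraph.IsTree.exists_bagTree [Fintype ι] (hT : T.IsTree)
    (hX : ∀ v : V, (T.induce {t | v ∈ X t}).Connected) :
    ∃ t : BagTree V, t.Valid ∅ ∧ t.bags = Set.range X := by
  have : 0 < Fintype.card ι := Fintype.card_pos_iff.2 hT.connected.nonempty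
  obtain ⟨A, t, hc, -, ht, hb, -⟩ := hT.exists_bagTree_of_card hX (Fintype.card ι - 1) (by omega)
  refine ⟨t, ht, ?_⟩
  rw [hb, (Finset.card_eq_iff_eq_univ A).1 (by omega)]
  simp

end

theorem four_mul_size_le (n : ℕ) :
    ((4 * n.size : ℕ) : ℤ) ≤ 2 * ⌈Real.logb (5 / 4) (2 * (n : ℝ))⌉ := by
  rcases Nat.eq_zero_or_pos n with rfl | hn
  · simp
  have hs : 0 < n.size := Nat.size_pos.2 hn
  have h1 : 2 ^ (n.size - 1) ≤ n := Nat.lt_size.1 (by omega)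
  have h2 : 2 ^ n.size ≤ 2 * n := by
    obtain ⟨s, hs'⟩ : ∃ s, n.size = s + 1 := ⟨n.size - 1, by omega⟩
    rw [hs'] at h1 ⊢
    rw [pow_succ]
    simp only [Nat.add_sub_cancel] at h1
    omega
  have h3 : ((2 * n.size : ℕ) : ℝ) ≤ Real.logb (5 / 4) (2 * (n : ℝ)) := by
    rw [Real.le_logb_iff_rpow_le (by norm_num) (by positivity), Real.rpow_natCast, pow_mul]
    calc ((5 / 4 : ℝ) ^ 2) ^ n.size ≤ 2 ^ n.size := by
          gcongr; norm_num
      _ ≤ 2 * (n : ℝ) := by exact_mod_cast h2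
  have h4 : ((2 * n.size : ℕ) : ℤ) ≤ ⌈Real.logb (5 / 4) (2 * (n : ℝ))⌉ := by
    exact_mod_cast h3.trans (Int.le_ceil _)
  push_cast at h4 ⊢
  omega

/-- every graph of treewidth `k` with `n` vertices admits a
tree-decomposition of width at most `3k+2` whose tree is binary (rooted at `r`, every
node has at most two children) of depth at most `2⌈log_{5/4}(2n)⌉`. -/
theorem balanced_binary_tree_decomposition {V : Type} [Fintype V]
    (G : SimpleGraph V) (k : ℕ) (h : HasTreewidthAtMost G k) :
    ∃ (n : ℕ) (T : SimpleGraph (Fin n)) (X : Fin n → Finset V) (r : Fin n),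
      T.IsTree ∧
      (∀ t, (X t).card ≤ (3 * k + 2) + 1) ∧
      (∀ v : V, ∃ t, v ∈ X t) ∧
      (∀ u v : V, G.Adj u v → ∃ t, u ∈ X t ∧ v ∈ X t) ∧
      (∀ v : V, (T.induce {t | v ∈ X t}).Connected) ∧
      (∀ t : Fin n, {u | T.Adj t u ∧ T.dist r u = T.dist r t + 1}.ncard ≤ 2) ∧
      (∀ t : Fin n,
        (T.dist r t : ℤ) ≤ 2 * ⌈Real.logb (5 / 4) (2 * (Fintype.card V : ℝ))⌉) := by
  obtain ⟨n₀, T₀, X₀, hT₀, hc₀, hv₀, he₀, hX₀⟩ := h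
  obtain ⟨t₀, ht₀, hb₀⟩ := hT₀.exists_bagTree hX₀
  have hw : t₀.weight ∅ < 2 ^ (Fintype.card V).size :=
    (ht₀.weight_le.trans (Finset.card_le_univ _)).trans_lt (Nat.lt_size_self _)
  obtain ⟨t, ht, -, hcov, hcard, hheight⟩ :=
    (BagTree.hasTree_of_weight_lt (c := k + 1) (Fintype.card V).size).1 ∅ t₀ ht₀ (by simp)
      (by rw [hb₀]; rintro _ ⟨i, rfl⟩; exact hc₀ i) hw
  obtain ⟨n, T, X, r, hT, hX, hbag, hconn, hchild, hdist⟩ := ht.exists_decomposition hheight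
  have hcover : ∀ i v, v ∈ X₀ i → ∃ j, X₀ i ⊆ X j := by
    intro i v hv
    obtain ⟨Z, hZ, hsub⟩ := hcov (X₀ i) (by simp [hb₀])
    obtain ⟨j, rfl⟩ := hbag Z hZ ⟨v, hsub hv⟩
    exact ⟨j, hsub⟩
  have hmem : ∀ v, ∃ j, v ∈ X j := by
    intro v
    obtain ⟨i, hi⟩ := hv₀ v
    obtain ⟨j, hj⟩ := hcover i v hi
    exact ⟨j, hj hi⟩
  refine ⟨n, T, X, r, hT, ?_, hmem, ?_, ?_, hchild, ?_⟩
  · intro i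
    rcases hX i with h | h
    · simp [h]
    · have := hcard _ h
      omega
  · intro u v huv
    obtain ⟨i, hu, hv⟩ := he₀ u v huv
    obtain ⟨j, hj⟩ := hcover i u hu
    exact ⟨j, hj hu, hj hv⟩
  · intro v
    obtain ⟨j, hj⟩ := hmem v
    refine hconn v ?_
    rcases hX j with h | h
    · simp [h] at hj
    · exact BagTree.subset_verts h hj
  · intro i
    exact (Int.ofNat_le.2 (hdist i)).trans (four_mul_size_le _)
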